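/- arXiv:1611.08180 — 2 statements merged into one kernel-verified Lean document; each statement's English description precedes it below -/
import Mathlib

section
/- There exist infinitely many positive integers n such that |s_3(n) - s_2(n)| ≤ 0.1457205 · log n. -/
open Filter

/-- `digitSum b n` is the sum of the digits of `n` in base `b`. -/
def digitSum (b n : ℕ) : ℕ := (Nat.digits b n).sum

theorem digitSum_add_mul {b : ℕ} (hb : 2 ≤ b) {d : ℕ} (hd : d < b) (y : ℕ) :
    digitSum b (d + b * y) = d + digitSum b y := by
  unfold digitSum
  rcases Nat.eq_zero_or_pos (d + b * y) with h | h
  · have hd0 : d = 0 := by omega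
    have hy : y = 0 := by
      have : b * y = 0 := by omega
      rcases Nat.mul_eq_zero.1 this with h | h <;> omega
    simp [hd0, hy]
  · rw [Nat.digits_def' (by omega) h, List.sum_cons, Nat.add_mul_mod_self_left,
      Nat.mod_eq_of_lt hd, Nat.add_mul_div_left _ _ (by omega), Nat.div_eq_of_lt hd, zero_add]

theorem digitSum_two_eq_add (L n : ℕ) :
    digitSum 2 n = digitSum 2 (n % 2 ^ L) + digitSum 2 (n / 2 ^ L) := by
  induction L generalizing n with
  | zero => simp [Nat.mod_one, digitSum]
  | succ L ih =>
    have h1 := digitSum_add_mul le_rfl (Nat.mod_lt n two_pos) (n / 2)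
    have h2 := digitSum_add_mul le_rfl (Nat.mod_lt n two_pos) (n / 2 % 2 ^ L)
    rw [Nat.mod_add_div] at h1
    rw [pow_succ', Nat.mod_mul, ← Nat.div_div_eq_div_mul, h1, h2, ih (n / 2), add_assoc]

theorem digitSum_two_le {n j : ℕ} (h : n < 2 ^ j) : digitSum 2 n ≤ j := by
  induction j generalizing n with
  | zero =>
    have : n = 0 := by simpa using h
    simp [this, digitSum]
  | succ j ih =>
    have h1 := digitSum_add_mul le_rfl (Nat.mod_lt n two_pos) (n / 2)
    rw [Nat.mod_add_div] at h1
    have := ih (n := n / 2) (by rw [pow_succ] at h; omega)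
    omega

theorem sum_sq_digitSum_two (l : ℕ) :
    ∑ x ∈ Finset.range (2 ^ l), (2 * (digitSum 2 x : ℤ) - l) ^ 2 = (2 : ℤ) ^ l * l := by
  have split (F : ℕ → ℤ) (n : ℕ) : ∑ x ∈ Finset.range (2 * n), F x =
      ∑ y ∈ Finset.range n, (F (0 + 2 * y) + F (1 + 2 * y)) := by
    induction n with
    | zero => simp
    | succ n ih =>
      rw [mul_add, mul_one, Finset.sum_range_succ, Finset.sum_range_succ, ih,
        Finset.sum_range_succ, zero_add, add_comm 1, add_assoc]
  induction l with
  | zero => simp [digitSum]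
  | succ l ih =>
    have key (y : ℕ) : (2 * (digitSum 2 (0 + 2 * y) : ℤ) - (l + 1 : ℕ)) ^ 2 +
        (2 * (digitSum 2 (1 + 2 * y) : ℤ) - (l + 1 : ℕ)) ^ 2 =
        2 * (2 * (digitSum 2 y : ℤ) - l) ^ 2 + 2 := by
      rw [digitSum_add_mul le_rfl (by norm_num), digitSum_add_mul le_rfl (by norm_num)]
      push_cast
      ring
    rw [pow_succ', split, Finset.sum_congr rfl fun y _ ↦ key y, Finset.sum_add_distrib,
      ← Finset.mul_sum, ih]
    simp
    ring

theorem sum_sq_digitSum_three (l : ℕ) :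
    ∑ x ∈ Finset.range (3 ^ l), ((digitSum 3 x : ℤ) - l) ^ 2 ≤ (3 : ℤ) ^ l * l := by
  have split (F : ℕ → ℤ) (n : ℕ) : ∑ x ∈ Finset.range (3 * n), F x =
      ∑ y ∈ Finset.range n, (F (0 + 3 * y) + F (1 + 3 * y) + F (2 + 3 * y)) := by
    induction n with
    | zero => simp
    | succ n ih =>
      rw [mul_add, mul_one, Finset.sum_range_succ, Finset.sum_range_succ, Finset.sum_range_succ,
        ih, Finset.sum_range_succ, zero_add, add_comm 1, add_comm 2]
      ring
  induction l with
  | zero => simp [digitSum]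
  | succ l ih =>
    have key (y : ℕ) : ((digitSum 3 (0 + 3 * y) : ℤ) - (l + 1 : ℕ)) ^ 2 +
        ((digitSum 3 (1 + 3 * y) : ℤ) - (l + 1 : ℕ)) ^ 2 +
        ((digitSum 3 (2 + 3 * y) : ℤ) - (l + 1 : ℕ)) ^ 2 =
        3 * ((digitSum 3 y : ℤ) - l) ^ 2 + 2 := by
      rw [digitSum_add_mul (by norm_num) (by norm_num), digitSum_add_mul (by norm_num) (by norm_num),
        digitSum_add_mul (by norm_num) (by norm_num)]
      push_cast
      ring
    rw [pow_succ', split, Finset.sum_congr rfl fun y _ ↦ key y, Finset.sum_add_distrib,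
      ← Finset.mul_sum]
    have : (0 : ℤ) < 3 ^ l := by positivity
    simp only [Finset.sum_const, Finset.card_range, nsmul_eq_mul]
    push_cast
    rw [pow_succ']
    nlinarith

/-- A counting form of Chebyshev's inequality. -/
theorem card_filter_le_abs_mul_sq_le (f : ℕ → ℤ) (N t : ℕ) :
    (((Finset.range N).filter fun x ↦ (t : ℤ) ≤ |f x|).card : ℤ) * t ^ 2 ≤
      ∑ x ∈ Finset.range N, f x ^ 2 := by
  rw [← nsmul_eq_mul]
  refine (Finset.card_nsmul_le_sum _ (fun x ↦ f x ^ 2) _ fun x hx ↦ ?_).trans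
    (Finset.sum_le_sum_of_subset_of_nonneg (Finset.filter_subset _ _) fun _ _ _ ↦ sq_nonneg _)
  rw [← sq_abs (f x)]
  exact pow_le_pow_left₀ (by positivity) (Finset.mem_filter.1 hx).2 2

/-- Fibres of `m ↦ b * m / a` have at most `a / b + 2` elements. -/
theorem card_filter_mul_div_le {a b : ℕ} (ha : 0 < a) (hb : 0 < b) (s B : Finset ℕ) :
    (s.filter fun m ↦ b * m / a ∈ B).card ≤ (a / b + 2) * B.card := by
  refine Finset.card_le_mul_card_image_of_maps_to (f := fun m ↦ b * m / a)
    (fun m hm ↦ (Finset.mem_filter.1 hm).2) _ fun h _ ↦ ?_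
  have hsub : ((s.filter fun m ↦ b * m / a ∈ B).filter fun m ↦ b * m / a = h) ⊆
      Finset.Icc (h * a / b) (h * a / b + a / b + 1) := by
    intro m hm
    have hm' : b * m / a = h := (Finset.mem_filter.1 hm).2
    rw [Nat.div_eq_iff ha] at hm'
    have e1 := Nat.div_add_mod (h * a) b
    have e2 := Nat.div_add_mod a b
    have l1 := Nat.mod_lt (h * a) hb
    have l2 := Nat.mod_lt a hb
    rw [Finset.mem_Icc]
    constructor
    · exact Nat.div_le_of_le_mul (by omega)
    · by_contra! hlt
      have : b * (h * a / b + a / b + 2) ≤ b * m := Nat.mul_le_mul_left _ hlt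
      have e3 : b * (h * a / b + a / b + 2) = b * (h * a / b) + b * (a / b) + 2 * b := by ring
      omega
  refine (Finset.card_le_card hsub).trans ?_
  rw [Nat.card_Icc, add_assoc, add_assoc, Nat.add_sub_cancel_left]

/-- The multiples `3 ^ q * m` with `m < 2 ^ L` contain an element for which the low binary digits,
the high binary digits and the ternary digits are all balanced. -/
theorem exists_balanced_multiple {q L T K t : ℕ} (hqL : 3 ^ q ≤ 2 ^ L) (hT : 3 ^ q ≤ 2 ^ T)
    (hT' : 2 ^ T ≤ 2 * 3 ^ q) (hK : 2 ^ L ≤ 3 ^ K) (hK' : 3 ^ K ≤ 3 * 2 ^ L)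
    (ht : L + 6 * T + 3 * K < t ^ 2) :
    ∃ m : ℕ, |2 * (digitSum 2 (3 ^ q * m % 2 ^ L) : ℤ) - L| < t ∧
      |2 * (digitSum 2 (3 ^ q * m / 2 ^ L) : ℤ) - T| < t ∧
      |(digitSum 3 m : ℤ) - K| < t := by
  by_contra! hcon
  set R := Finset.range (2 ^ L)
  set A := R.filter fun x ↦ (t : ℤ) ≤ |2 * (digitSum 2 x : ℤ) - L| with hA
  set B := (Finset.range (2 ^ T)).filter fun x ↦ (t : ℤ) ≤ |2 * (digitSum 2 x : ℤ) - T| with hB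
  set C := (Finset.range (3 ^ K)).filter fun x ↦ (t : ℤ) ≤ |(digitSum 3 x : ℤ) - K| with hC
  have cA : (A.card : ℤ) * t ^ 2 ≤ 2 ^ L * L :=
    (card_filter_le_abs_mul_sq_le _ _ _).trans_eq (sum_sq_digitSum_two L)
  have cB : (B.card : ℤ) * t ^ 2 ≤ 2 ^ T * T :=
    (card_filter_le_abs_mul_sq_le _ _ _).trans_eq (sum_sq_digitSum_two T)
  have cC : (C.card : ℤ) * t ^ 2 ≤ 3 ^ K * K :=
    (card_filter_le_abs_mul_sq_le _ _ _).trans (sum_sq_digitSum_three K)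
  have hcop : Nat.Coprime (2 ^ L) (3 ^ q) := Nat.Coprime.pow _ _ (by norm_num)
  have cA' : (R.filter fun m ↦ 3 ^ q * m % 2 ^ L ∈ A).card ≤ A.card := by
    refine Finset.card_le_card_of_injOn (fun m ↦ 3 ^ q * m % 2 ^ L)
      (fun m hm ↦ (Finset.mem_filter.1 hm).2) fun x hx y hy hxy ↦ ?_
    have hx' := Finset.mem_range.1 (Finset.mem_filter.1 hx).1
    have hy' := Finset.mem_range.1 (Finset.mem_filter.1 hy).1
    exact (Nat.ModEq.cancel_left_of_coprime hcop hxy).eq_of_lt_of_lt hx' hy'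
  have cB' := card_filter_mul_div_le (a := 2 ^ L) (b := 3 ^ q) (by positivity) (by positivity) R B
  have hcover : R ⊆ (R.filter fun m ↦ 3 ^ q * m % 2 ^ L ∈ A) ∪
      (R.filter fun m ↦ 3 ^ q * m / 2 ^ L ∈ B) ∪ C := by
    intro m hm
    have hmL : m < 2 ^ L := Finset.mem_range.1 hm
    have h1 : 3 ^ q * m % 2 ^ L < 2 ^ L := Nat.mod_lt _ (by positivity)
    have h2 : 3 ^ q * m / 2 ^ L < 2 ^ T :=
      (Nat.div_lt_of_lt_mul (by
        rw [mul_comm]; exact Nat.mul_lt_mul_of_pos_right hmL (by positivity))).trans_le hT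
    have h3 : m < 3 ^ K := hmL.trans_le hK
    simp only [Finset.mem_union, Finset.mem_filter, hA, hB, hC, hm, R, Finset.mem_range, h1, h2, h3,
      true_and]
    by_contra! hno
    exact absurd (hcon m hno.1.1 hno.1.2) (not_le.2 hno.2)
  have hcard := (Finset.card_le_card hcover).trans ((Finset.card_union_le _ _).trans
    (Nat.add_le_add_right (Finset.card_union_le _ _) _))
  have hfin : 2 ^ L ≤ A.card + (2 ^ L / 3 ^ q + 2) * B.card + C.card := by
    have : R.card = 2 ^ L := Finset.card_range _
    omega
  have hd1 : 1 ≤ 2 ^ L / 3 ^ q := Nat.div_pos hqL (by positivity)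
  have hd2 : 2 ^ L / 3 ^ q * 3 ^ q ≤ 2 ^ L := Nat.div_mul_le_self _ _
  generalize 2 ^ L / 3 ^ q = d at *
  norm_cast at cA cB cC
  have b1 : (d + 2) * B.card * t ^ 2 ≤ 2 ^ L * (6 * T) := calc
    (d + 2) * B.card * t ^ 2 ≤ (3 * d) * (B.card * t ^ 2) := by
      rw [mul_assoc]; exact Nat.mul_le_mul_right _ (by omega)
    _ ≤ (3 * d) * (2 * 3 ^ q * T) := by exact Nat.mul_le_mul_left _ (cB.trans (by gcongr))
    _ = (d * 3 ^ q) * (6 * T) := by ring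
    _ ≤ _ := by gcongr
  have c1 : C.card * t ^ 2 ≤ 2 ^ L * (3 * K) := calc
    C.card * t ^ 2 ≤ 3 * 2 ^ L * K := cC.trans (by gcongr)
    _ = _ := by ring
  have f1 := Nat.mul_le_mul_right (t ^ 2) hfin
  have f2 : 2 ^ L * (L + 6 * T + 3 * K) < 2 ^ L * t ^ 2 :=
    Nat.mul_lt_mul_of_pos_left ht (by positivity)
  nlinarith

/-- There are infinitely many positive integers `n` with
`|s₃(n) - s₂(n)| ≤ 0.1457205 · log n`. -/
theorem infinitely_many_close_digit_sums :
    {n : ℕ | 0 < n ∧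
      |(digitSum 3 n : ℝ) - (digitSum 2 n : ℝ)| ≤ 0.1457205 * Real.log n}.Infinite := by
  refine Set.infinite_of_forall_exists_gt fun N ↦ ?_
  obtain ⟨t, htN, ht⟩ : ∃ t : ℕ, N ≤ t ∧ 1000 ≤ t := ⟨N + 1000, by omega, by omega⟩
  set T := Nat.clog 2 (3 ^ (10 * t))
  set K := Nat.clog 3 (2 ^ (60 * t))
  have hT : 3 ^ (10 * t) ≤ 2 ^ T := Nat.le_pow_clog (by norm_num) _
  have hK : 2 ^ (60 * t) ≤ 3 ^ K := Nat.le_pow_clog (by norm_num) _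
  have one_lt3 : 1 < 3 ^ (10 * t) := Nat.one_lt_pow (by omega) (by norm_num)
  have one_lt2 : 1 < 2 ^ (60 * t) := Nat.one_lt_pow (by omega) (by norm_num)
  have hT0 : 0 < T := Nat.clog_pos (by norm_num) one_lt3
  have hK0 : 0 < K := Nat.clog_pos (by norm_num) one_lt2
  have hT1 : 2 ^ (T - 1) < 3 ^ (10 * t) := Nat.pow_pred_clog_lt_self (by norm_num) one_lt3
  have hK1 : 3 ^ (K - 1) < 2 ^ (60 * t) := Nat.pow_pred_clog_lt_self (by norm_num) one_lt2
  have hT' : 2 ^ T ≤ 2 * 3 ^ (10 * t) := by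
    calc 2 ^ T = 2 * 2 ^ (T - 1) := (mul_pow_sub_one hT0.ne' 2).symm
      _ ≤ _ := Nat.mul_le_mul_left _ hT1.le
  have hK' : 3 ^ K ≤ 3 * 2 ^ (60 * t) := by
    calc 3 ^ K = 3 * 3 ^ (K - 1) := (mul_pow_sub_one hK0.ne' 3).symm
      _ ≤ _ := Nat.mul_le_mul_left _ hK1.le
  -- Compare powers using `2 ^ 11 < 3 ^ 7` and `3 ^ 5 < 2 ^ 8`.
  have low (j : ℕ) : 2 ^ (11 * j) ≤ 3 ^ (7 * j) := by
    rw [pow_mul, pow_mul]; exact Nat.pow_le_pow_left (by norm_num) _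
  have high (j : ℕ) : 3 ^ (5 * j) ≤ 2 ^ (8 * j) := by
    rw [pow_mul, pow_mul]; exact Nat.pow_le_pow_left (by norm_num) _
  have three_le : 3 ^ (10 * t) ≤ 2 ^ (16 * t) := by
    rw [show 10 * t = 5 * (2 * t) by ring, show 16 * t = 8 * (2 * t) by ring]
    exact high _
  have T_le : T - 1 < 16 * t :=
    (Nat.pow_lt_pow_iff_right (a := 2) (by norm_num)).1 (hT1.trans_le three_le)
  have le_T : 110 * t ≤ 7 * T := by
    refine (Nat.pow_le_pow_iff_right (a := 2) (by norm_num)).1 ?_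
    calc 2 ^ (110 * t) = 2 ^ (11 * (10 * t)) := by ring_nf
      _ ≤ 3 ^ (7 * (10 * t)) := low _
      _ = (3 ^ (10 * t)) ^ 7 := by ring
      _ ≤ (2 ^ T) ^ 7 := Nat.pow_le_pow_left hT _
      _ = 2 ^ (7 * T) := by ring
  have le_K : 300 * t ≤ 8 * K := by
    refine (Nat.pow_le_pow_iff_right (a := 2) (by norm_num)).1 ?_
    calc 2 ^ (300 * t) = (2 ^ (60 * t)) ^ 5 := by ring
      _ ≤ (3 ^ K) ^ 5 := Nat.pow_le_pow_left hK _
      _ = 3 ^ (5 * K) := by ring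
      _ ≤ 2 ^ (8 * K) := high _
  have K_le : 11 * (K - 1) ≤ 420 * t := by
    refine (Nat.pow_le_pow_iff_right (a := 3) (by norm_num)).1 ?_
    calc 3 ^ (11 * (K - 1)) = (3 ^ (K - 1)) ^ 11 := by ring
      _ ≤ (2 ^ (60 * t)) ^ 11 := Nat.pow_le_pow_left hK1.le _
      _ = 2 ^ (11 * (60 * t)) := by ring
      _ ≤ 3 ^ (7 * (60 * t)) := low _
      _ = 3 ^ (420 * t) := by ring_nf
  have hqL : 3 ^ (10 * t) ≤ 2 ^ (60 * t) :=
    three_le.trans (Nat.pow_le_pow_right (by norm_num) (by omega))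
  obtain ⟨m, h1, h2, h3⟩ := exists_balanced_multiple (t := t) hqL hT hT' hK hK' (by
    have : 1000 * t ≤ t ^ 2 := by rw [sq]; exact Nat.mul_le_mul_right _ ht
    omega)
  have s3 (q : ℕ) : digitSum 3 (3 ^ q * m) = digitSum 3 m := by
    induction q with
    | zero => simp
    | succ q ih =>
      have := digitSum_add_mul (b := 3) (d := 0) (by norm_num) (by norm_num) (3 ^ q * m)
      rw [pow_succ', mul_assoc, ← ih]
      simpa using this
  have hs2 := digitSum_two_eq_add (60 * t) (3 ^ (10 * t) * m)
  have hs3 := s3 (10 * t)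
  generalize 3 ^ (10 * t) * m = n at *
  rw [abs_lt] at h1 h2 h3
  push_cast at h1
  have hn : 2 ^ (30 * t) ≤ n := by
    by_contra! hlt
    have := digitSum_two_le hlt
    omega
  have hpos : 0 < n := (Nat.two_pow_pos _).trans_le hn
  have hlog : (20 : ℝ) * t ≤ Real.log n := by
    have hle : Real.log ((2 : ℝ) ^ (30 * t)) ≤ Real.log n :=
      Real.log_le_log (by positivity) (by exact_mod_cast hn)
    rw [Real.log_pow] at hle
    push_cast at hle
    have := Real.log_two_gt_d9
    have ht0 : (0 : ℝ) ≤ t := by positivity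
    nlinarith
  have hD : |10 * ((digitSum 3 n : ℤ) - digitSum 2 n)| ≤ 29 * t := by
    rw [abs_le]
    omega
  refine ⟨n, ⟨hpos, ?_⟩, ?_⟩
  · have hD' : |10 * ((digitSum 3 n : ℝ) - digitSum 2 n)| ≤ 29 * t := by exact_mod_cast hD
    rw [abs_mul, abs_of_pos (by norm_num : (0 : ℝ) < 10)] at hD'
    linarith
  · have : 30 * t < 2 ^ (30 * t) := Nat.lt_two_pow_self
    omega
end

section
/- For all sufficiently large integers N, setting K = ⌊log N/log 3⌋ − 2 and H = ⌊(K−1)·log 3/log 4⌋ + 2, the number of natural numbers n ≤ 2^{2H} with s_3(n) = H is at least N^{0.970359237}. -/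
open Filter Finset

theorem digitSum_three_mul_add (m d : ℕ) (hd : d < 3) :
    digitSum 3 (3 * m + d) = digitSum 3 m + d := by
  unfold digitSum
  by_cases h : d = 0 ∧ m = 0
  · simp [h]
  · rw [add_comm, Nat.digits_add 3 (by norm_num) d m hd (by tauto)]
    simp [add_comm]

theorem sum_range_three_mul (f : ℕ → ℕ) (m : ℕ) :
    ∑ n ∈ range (3 * m), f n = ∑ k ∈ range m, (f (3 * k) + f (3 * k + 1) + f (3 * k + 2)) := by
  induction m with
  | zero => simp
  | succ m ih =>
    rw [show 3 * (m + 1) = 3 * m + 1 + 1 + 1 by ring, sum_range_succ, sum_range_succ,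
      sum_range_succ, ih, sum_range_succ]
    ring

/-- The number of `n < 3 ^ L` whose ternary digits add up to `h`. -/
def ternaryCount (L h : ℕ) : ℕ := #{n ∈ range (3 ^ L) | digitSum 3 n = h}

theorem ternaryCount_succ (L h : ℕ) :
    ternaryCount (L + 1) h = ternaryCount L h + #{n ∈ range (3 ^ L) | digitSum 3 n + 1 = h}
      + #{n ∈ range (3 ^ L) | digitSum 3 n + 2 = h} := by
  simp only [ternaryCount, card_filter, pow_succ']
  rw [sum_range_three_mul, sum_add_distrib, sum_add_distrib]
  have h0 (m : ℕ) : digitSum 3 (3 * m) = digitSum 3 m :=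
    digitSum_three_mul_add m 0 (by norm_num)
  simp only [h0, digitSum_three_mul_add _ 1 (by norm_num), digitSum_three_mul_add _ 2 (by norm_num)]

/-- The strings with `a` zeros, `b` ones and `c` twos all have digit sum `b + 2 * c`. -/
theorem factorial_le_mul_ternaryCount (L : ℕ) : ∀ a b c : ℕ, a + b + c = L →
    L.factorial ≤ a.factorial * b.factorial * c.factorial * ternaryCount L (b + 2 * c) := by
  induction L with
  | zero =>
    intro a b c h
    obtain ⟨rfl, rfl, rfl⟩ : a = 0 ∧ b = 0 ∧ c = 0 := by omega
    simp [ternaryCount, digitSum, filter_singleton]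
  | succ L ih =>
    intro a b c h
    have ha : a * L.factorial ≤
        a.factorial * b.factorial * c.factorial * ternaryCount L (b + 2 * c) := by
      cases a with
      | zero => simp
      | succ a =>
        have := Nat.mul_le_mul_left (a + 1) (ih a b c (by omega))
        rw [Nat.factorial_succ a]
        linarith
    have hb : b * L.factorial ≤ a.factorial * b.factorial * c.factorial *
        #{n ∈ range (3 ^ L) | digitSum 3 n + 1 = b + 2 * c} := by
      cases b with
      | zero => simp
      | succ b =>
        have := Nat.mul_le_mul_left (b + 1) (ih a b c (by omega))
        rw [Nat.factorial_succ b, show b + 1 + 2 * c = b + 2 * c + 1 by ring]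
        simp only [add_left_inj]
        rw [ternaryCount] at this
        linarith
    have hc : c * L.factorial ≤ a.factorial * b.factorial * c.factorial *
        #{n ∈ range (3 ^ L) | digitSum 3 n + 2 = b + 2 * c} := by
      cases c with
      | zero => simp
      | succ c =>
        have := Nat.mul_le_mul_left (c + 1) (ih a b c (by omega))
        rw [Nat.factorial_succ c, show b + 2 * (c + 1) = b + 2 * c + 2 by ring]
        simp only [add_left_inj]
        rw [ternaryCount] at this
        linarith
    rw [ternaryCount_succ, Nat.factorial_succ, ← h]
    linarith

theorem log_factorial_le (n : ℕ) :
    Real.log n.factorial ≤ n * Real.log n - n + Real.log n + 1 := by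
  induction n with
  | zero => simp
  | succ n ih =>
    rcases Nat.eq_zero_or_pos n with rfl | hn
    · simp
    have hn' : (0 : ℝ) < n := by exact_mod_cast hn
    have key : 1 ≤ ((n : ℝ) + 1) * (Real.log (n + 1) - Real.log n) := by
      have := Real.log_le_sub_one_of_pos (show (0 : ℝ) < n / (n + 1) by positivity)
      rw [Real.log_div (by positivity) (by positivity)] at this
      have h2 : (n : ℝ) / (n + 1) - 1 = -(1 / (n + 1)) := by field_simp; ring
      rw [h2] at this
      have h3 : 1 / ((n : ℝ) + 1) ≤ Real.log (n + 1) - Real.log n := by linarith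
      rwa [div_le_iff₀' (by positivity)] at h3
    rw [Nat.factorial_succ, Nat.cast_mul,
      Real.log_mul (by positivity) (by positivity)]
    push_cast
    linarith

theorem le_log_factorial (n : ℕ) : n * Real.log n - n ≤ Real.log n.factorial := by
  rcases Nat.eq_zero_or_pos n with rfl | hn
  · simp
  have h := Stirling.le_log_factorial_stirling hn.ne'
  have h1 : 0 ≤ Real.log n := Real.log_natCast_nonneg n
  have h2 : 0 ≤ Real.log (2 * Real.pi) := Real.log_nonneg (by linarith [Real.pi_gt_three])
  linarith

theorem log_ternaryCount_ge {L a b c : ℕ} (hL : 0 < L) (h : a + b + c = L) :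
    L * (Real.negMulLog (a / L) + Real.negMulLog (b / L) + Real.negMulLog (c / L))
      - (3 * Real.log L + 3) ≤ Real.log (ternaryCount L (b + 2 * c)) := by
  have hf := factorial_le_mul_ternaryCount L a b c h
  have hpos : 0 < ternaryCount L (b + 2 * c) := by
    by_contra! h0
    rw [Nat.le_zero.mp h0] at hf
    have := Nat.factorial_pos L
    omega
  have hL' : (0 : ℝ) < L := by exact_mod_cast hL
  have hlog : Real.log L.factorial ≤ Real.log a.factorial + Real.log b.factorial
      + Real.log c.factorial + Real.log (ternaryCount L (b + 2 * c)) := by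
    rw [← Real.log_mul (by positivity) (by positivity),
      ← Real.log_mul (by positivity) (by positivity),
      ← Real.log_mul (by positivity) (by positivity)]
    exact Real.log_le_log (by positivity) (by exact_mod_cast hf)
  have hent (m : ℕ) : L * Real.negMulLog (m / L) = m * Real.log L - m * Real.log m := by
    rcases Nat.eq_zero_or_pos m with rfl | hm
    · simp
    have hm' : (0 : ℝ) < m := by exact_mod_cast hm
    rw [Real.negMulLog, Real.log_div (by positivity) (by positivity)]
    field_simp
    ring
  have hmono {m : ℕ} (hm : m ≤ L) : Real.log m ≤ Real.log L := by
    rcases Nat.eq_zero_or_pos m with rfl | hm0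
    · simpa using Real.log_natCast_nonneg L
    · exact Real.log_le_log (by exact_mod_cast hm0) (by exact_mod_cast hm)
  have hsum : (L : ℝ) = a + b + c := by exact_mod_cast h.symm
  have hLL : (L : ℝ) * Real.log L = a * Real.log L + b * Real.log L + c * Real.log L := by
    rw [← add_mul, ← add_mul, ← hsum]
  rw [mul_add, mul_add, hent, hent, hent]
  linarith [log_factorial_le a, log_factorial_le b, log_factorial_le c, le_log_factorial L,
    hmono (show a ≤ L by omega), hmono (show b ≤ L by omega), hmono (show c ≤ L by omega)]

theorem log_two_bounds :
    0.69314718055 < Real.log 2 ∧ Real.log 2 < 0.69314718057 := by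
  have h1 := Real.sum_range_le_log_div (x := 1 / 3) (by norm_num) (by norm_num) 12
  have h2 := Real.log_div_le_sum_range_add (x := 1 / 3) (by norm_num) (by norm_num) 12
  norm_num [sum_range_succ] at h1 h2
  constructor <;> linarith

theorem log_three_bounds :
    1.09861228866 < Real.log 3 ∧ Real.log 3 < 1.09861228868 := by
  have h1 := Real.sum_range_le_log_div (x := 1 / 2) (by norm_num) (by norm_num) 20
  have h2 := Real.log_div_le_sum_range_add (x := 1 / 2) (by norm_num) (by norm_num) 20
  norm_num [sum_range_succ] at h1 h2
  constructor <;> linarith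

theorem lt_log_188_div_137 : 0.31646103700 < Real.log (188 / 137) := by
  have h1 := Real.sum_range_le_log_div (x := 51 / 325) (by norm_num) (by norm_num) 8
  norm_num [sum_range_succ] at h1
  linarith

theorem lt_log_79869_div_35344 : 0.81525914582 < Real.log (79869 / 35344) := by
  have h1 := Real.sum_range_le_log_div (x := 44525 / 115213) (by norm_num) (by norm_num) 14
  norm_num [sum_range_succ] at h1
  linarith

theorem log_three_div_log_four_bounds :
    0.79248125033 < Real.log 3 / Real.log 4 ∧ Real.log 3 / Real.log 4 < 0.79248125040 := by
  obtain ⟨h1, h2⟩ := log_two_bounds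
  obtain ⟨h3, h4⟩ := log_three_bounds
  have h : Real.log 4 = 2 * Real.log 2 := by
    rw [show (4 : ℝ) = 2 ^ 2 by norm_num, Real.log_pow]
    norm_num
  rw [h, lt_div_iff₀ (by linarith), div_lt_iff₀ (by linarith)]
  constructor <;> linarith

theorem neg_mul_log_sub_le_negMulLog {p q : ℝ} (hp : 0 < p) (hq : 0 < q) :
    -p * Real.log q - p * (p / q - 1) ≤ Real.negMulLog p := by
  have h := Real.log_le_sub_one_of_pos (div_pos hp hq)
  rw [Real.log_div hp.ne' hq.ne'] at h
  rw [Real.negMulLog]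
  nlinarith

/-- The entropy of a distribution on the digits `0, 1, 2` with mean `log 3 / log 4`. It is close to
the one proportional to `1, x, x ^ 2` with `x = 137 / 188`, which nearly maximizes the entropy. -/
theorem lt_entropy {r : ℝ} (hr : r = Real.log 3 / Real.log 4) :
    0.970359237 * Real.log 3 < Real.negMulLog (1 - r + 18769 / 79869)
      + Real.negMulLog (r - 2 * (18769 / 79869)) + Real.negMulLog (18769 / 79869) := by
  obtain ⟨hr1, hr2⟩ := log_three_div_log_four_bounds
  rw [← hr] at hr1 hr2
  have h0 := neg_mul_log_sub_le_negMulLog (p := 1 - r + 18769 / 79869) (q := 35344 / 79869)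
    (by linarith) (by norm_num)
  have h1 := neg_mul_log_sub_le_negMulLog (p := r - 2 * (18769 / 79869)) (q := 25756 / 79869)
    (by linarith) (by norm_num)
  have e0 : Real.log (35344 / 79869) = -Real.log (79869 / 35344) := by
    rw [← Real.log_inv]
    norm_num
  have e1 : Real.log (25756 / 79869) =
      -Real.log (79869 / 35344) - Real.log (188 / 137) := by
    rw [← Real.log_inv, ← Real.log_div (by norm_num) (by norm_num)]
    norm_num
  have e2 : Real.log (18769 / 79869) =
      -Real.log (79869 / 35344) - 2 * Real.log (188 / 137) := by
    rw [two_mul, ← sub_sub, ← Real.log_inv, ← Real.log_div (by norm_num) (by norm_num),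
      ← Real.log_div (by norm_num) (by norm_num)]
    norm_num
  have h2 : Real.negMulLog (18769 / 79869) = -(18769 / 79869) * Real.log (18769 / 79869) := rfl
  rw [e0] at h0
  rw [e1] at h1
  rw [e2] at h2
  have hx := lt_log_188_div_137
  have hZ := lt_log_79869_div_35344
  have hrx := mul_le_mul hr1.le hx.le (by norm_num) (by linarith)
  have hrr := mul_nonneg (sub_nonneg.mpr hr1.le) (sub_nonneg.mpr hr2.le)
  have h3 := log_three_bounds.2
  nlinarith

theorem tendsto_digitSum_target_div {r : ℝ} (hr : 0 ≤ r) :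
    Tendsto (fun K : ℕ => ((⌊((K : ℝ) - 1) * r⌋₊ + 2 : ℕ) : ℝ) / K) atTop (nhds r) := by
  have hinv : Tendsto (fun K : ℕ => (1 : ℝ) / K) atTop (nhds 0) :=
    tendsto_one_div_atTop_nhds_zero_nat
  have lo : Tendsto (fun K : ℕ => r + (1 - r) * ((1 : ℝ) / K)) atTop (nhds r) := by
    simpa using (hinv.const_mul (1 - r)).const_add r
  have hi : Tendsto (fun K : ℕ => r + (2 - r) * ((1 : ℝ) / K)) atTop (nhds r) := by
    simpa using (hinv.const_mul (2 - r)).const_add r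
  refine tendsto_of_tendsto_of_tendsto_of_le_of_le' lo hi ?_ ?_
  · filter_upwards [eventually_ge_atTop 1] with K hK
    have hK' : (1 : ℝ) ≤ K := by exact_mod_cast hK
    have := Nat.lt_floor_add_one (((K : ℝ) - 1) * r)
    rw [le_div_iff₀ (by linarith), add_mul, mul_assoc, one_div_mul_cancel (by linarith)]
    push_cast
    linarith
  · filter_upwards [eventually_ge_atTop 1] with K hK
    have hK' : (1 : ℝ) ≤ K := by exact_mod_cast hK
    have := Nat.floor_le (show 0 ≤ ((K : ℝ) - 1) * r from mul_nonneg (by linarith) hr)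
    rw [div_le_iff₀ (by linarith), add_mul, mul_assoc, one_div_mul_cancel (by linarith)]
    push_cast
    linarith

theorem eventually_le_log_ternaryCount {g r θ : ℝ} (hg : 0 ≤ g) (hr : 2 * g < r) (hr1 : r < 1 + g)
    (hθ : θ < Real.negMulLog (1 - r + g) + Real.negMulLog (r - 2 * g) + Real.negMulLog g) :
    ∀ᶠ K : ℕ in atTop,
      θ * (K + 3) ≤ Real.log (ternaryCount K (⌊((K : ℝ) - 1) * r⌋₊ + 2)) := by
  set H : ℕ → ℕ := fun K => ⌊((K : ℝ) - 1) * r⌋₊ + 2 with hH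
  set c : ℕ → ℕ := fun K => ⌊g * (K : ℝ)⌋₊ with hc
  have tH : Tendsto (fun K : ℕ => (H K : ℝ) / K) atTop (nhds r) :=
    tendsto_digitSum_target_div (by linarith)
  have tc : Tendsto (fun K : ℕ => (c K : ℝ) / K) atTop (nhds g) :=
    (tendsto_nat_floor_mul_div_atTop hg).comp tendsto_natCast_atTop_atTop
  have tb : Tendsto (fun K : ℕ => (H K : ℝ) / K - 2 * ((c K : ℝ) / K)) atTop
      (nhds (r - 2 * g)) := tH.sub (tc.const_mul 2)
  have ta : Tendsto (fun K : ℕ => 1 - (H K : ℝ) / K + (c K : ℝ) / K) atTop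
      (nhds (1 - r + g)) := (tH.const_sub 1).add tc
  have tinv : Tendsto (fun K : ℕ => (1 : ℝ) / K) atTop (nhds 0) :=
    tendsto_one_div_atTop_nhds_zero_nat
  have tlog : Tendsto (fun K : ℕ => Real.log K / K) atTop (nhds 0) := by
    have h := Real.isLittleO_log_id_atTop.tendsto_div_nhds_zero
    exact h.comp tendsto_natCast_atTop_atTop
  have key : Tendsto (fun K : ℕ =>
      Real.negMulLog (1 - (H K : ℝ) / K + (c K : ℝ) / K)
        + Real.negMulLog ((H K : ℝ) / K - 2 * ((c K : ℝ) / K)) + Real.negMulLog ((c K : ℝ) / K)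
        - 3 * (Real.log K / K) - (3 + 3 * θ) * ((1 : ℝ) / K)) atTop
      (nhds (Real.negMulLog (1 - r + g) + Real.negMulLog (r - 2 * g) + Real.negMulLog g
        - 3 * 0 - (3 + 3 * θ) * 0)) :=
    (((((Real.continuous_negMulLog.tendsto _).comp ta).add
      ((Real.continuous_negMulLog.tendsto _).comp tb)).add
      ((Real.continuous_negMulLog.tendsto _).comp tc)).sub (tlog.const_mul 3)).sub
      (tinv.const_mul _)
  filter_upwards [key.eventually_const_lt (show θ < _ by linarith),
    tb.eventually_const_lt (show 0 < r - 2 * g by linarith),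
    ta.eventually_const_lt (show 0 < 1 - r + g by linarith), eventually_gt_atTop 0]
    with K hK hb ha hK0
  have hK0' : (0 : ℝ) < K := by exact_mod_cast hK0
  have hb' : 2 * c K ≤ H K := by
    have : 0 < ((H K : ℝ) - 2 * c K) / K := by rwa [sub_div, mul_div_assoc]
    have := (div_pos_iff_of_pos_right hK0').mp this
    have : (2 * c K : ℝ) ≤ H K := by linarith
    exact_mod_cast this
  have ha' : H K ≤ K + c K := by
    have : 0 < ((K : ℝ) - H K + c K) / K := by
      rwa [add_div, sub_div, div_self hK0'.ne']
    have := (div_pos_iff_of_pos_right hK0').mp this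
    have : (H K : ℝ) ≤ K + c K := by linarith
    exact_mod_cast this
  have hmain := log_ternaryCount_ge (a := K + c K - H K) (b := H K - 2 * c K) (c := c K) hK0
    (by omega)
  rw [show H K - 2 * c K + 2 * c K = H K by omega, Nat.cast_sub ha', Nat.cast_sub hb'] at hmain
  push_cast at hmain
  rw [show ((K : ℝ) + c K - H K) / K = 1 - (H K : ℝ) / K + (c K : ℝ) / K by field_simp; ring,
    show ((H K : ℝ) - 2 * c K) / K = (H K : ℝ) / K - 2 * ((c K : ℝ) / K) by ring] at hmain
  refine le_trans ?_ hmain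
  have h2 := mul_le_mul_of_nonneg_left hK.le hK0'.le
  have h3 : (K : ℝ) * (3 * (Real.log K / K)) = 3 * Real.log K := by field_simp
  have h4 : (K : ℝ) * ((3 + 3 * θ) * ((1 : ℝ) / K)) = 3 + 3 * θ := by field_simp
  rw [mul_sub, mul_sub, h3, h4] at h2
  linarith

/-- For large `N`, with `K = ⌊log N/log 3⌋ − 2` and `H = ⌊(K−1)·log 3/log 4⌋ + 2`, the
number of `n ≤ 2^(2H)` with `s₃(n) = H` is at least `N^0.970359237`. -/
theorem count_s3_eq_H_lower_bound :
    ∀ᶠ N : ℕ in atTop,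
      ∀ K H : ℕ,
        K = ⌊Real.log N / Real.log 3⌋₊ - 2 →
        H = ⌊((K : ℝ) - 1) * Real.log 3 / Real.log 4⌋₊ + 2 →
        (N : ℝ) ^ (0.970359237 : ℝ)
          ≤ (((Finset.Iic (2 ^ (2 * H))).filter (fun n => digitSum 3 n = H)).card : ℝ) := by
  have hl3 : 0 < Real.log 3 := Real.log_pos (by norm_num)
  have hl4 : 0 < Real.log 4 := Real.log_pos (by norm_num)
  obtain ⟨hr1, hr2⟩ := log_three_div_log_four_bounds
  have hev := eventually_le_log_ternaryCount (g := 18769 / 79869) (by norm_num) (by linarith)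
    (by linarith) (lt_entropy rfl)
  have hfloor : Tendsto (fun N : ℕ => ⌊Real.log N / Real.log 3⌋₊ - 2) atTop atTop :=
    (tendsto_sub_atTop_nat 2).comp (tendsto_nat_floor_atTop.comp
      ((Real.tendsto_log_atTop.comp tendsto_natCast_atTop_atTop).atTop_div_const hl3))
  filter_upwards [hfloor.eventually hev, hfloor.eventually_ge_atTop 1, eventually_gt_atTop 0]
    with N hN hK1 hN0 K H hK hH
  rw [← hK] at hN hK1
  rw [← mul_div_assoc, ← hH] at hN
  have hN0' : (0 : ℝ) < N := by exact_mod_cast hN0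
  have hlogN : Real.log N ≤ (K + 3) * Real.log 3 := by
    have h1 := Nat.lt_floor_add_one (Real.log N / Real.log 3)
    have h2 : ⌊Real.log N / Real.log 3⌋₊ = K + 2 := by omega
    rw [h2, div_lt_iff₀ hl3] at h1
    push_cast at h1
    linarith
  have hpow : 3 ^ K ≤ 2 ^ (2 * H) := by
    have h1 := Nat.lt_floor_add_one (((K : ℝ) - 1) * Real.log 3 / Real.log 4)
    have h2 : (H : ℝ) = ⌊((K : ℝ) - 1) * Real.log 3 / Real.log 4⌋₊ + 2 := by
      rw [hH]
      push_cast
      ring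
    rw [div_lt_iff₀ hl4] at h1
    have h34 : Real.log 3 ≤ Real.log 4 := Real.log_le_log (by norm_num) (by norm_num)
    have h3 : (K : ℝ) * Real.log 3 ≤ H * Real.log 4 := by
      rw [h2]
      linarith
    rw [← Real.log_pow, ← Real.log_pow, Real.log_le_log_iff (by positivity) (by positivity)] at h3
    rw [pow_mul]
    exact_mod_cast h3
  have hcard : ternaryCount K H ≤
      ((Finset.Iic (2 ^ (2 * H))).filter (fun n => digitSum 3 n = H)).card := by
    refine card_le_card (filter_subset_filter _ fun n hn => ?_)
    rw [mem_range] at hn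
    exact mem_Iic.mpr (hn.le.trans hpow)
  have hbound : 0.970359237 * Real.log N ≤ Real.log (ternaryCount K H) := by
    refine le_trans ?_ hN
    linarith
  have hpos : (0 : ℝ) < ternaryCount K H := by
    rw [Nat.cast_pos, Nat.pos_iff_ne_zero]
    intro h0
    rw [h0, Nat.cast_zero, Real.log_zero] at hN
    have : (0 : ℝ) < 0.970359237 * Real.log 3 * (K + 3) := by positivity
    linarith
  refine le_trans ?_ (Nat.cast_le.mpr hcard)
  rw [← Real.log_le_log_iff (by positivity) hpos, Real.log_rpow hN0']
  exact hbound
end
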